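/- Let n₁, n₂ ≥ 1, n = n₁ + n₂ − 1, and r ≥ 1. Let U ∈ ℂ^{n₁×r} and V ∈ ℂ^{n₂×r} satisfy UᴴU = I_r and VᴴV = I_r, and define P_T(Z) = UUᴴZ + ZVVᴴ − UUᴴZVVᴴ. Let A(Z) = Σ_{k=0}^{n−1} ⟨Z, A_k⟩ A_k and A^⊥(Z) = Z − A(Z). Let j₀ ≥ 1, let Ω₁,…,Ω_{j₀} be multisets of elements of {0,…,n−1}, with A_{Ω_i}(Z) = Σ_{k ∈ Ω_i} ⟨Z, A_k⟩ A_k (summing with multiplicity), and let c ∈ ℝ. Let F₀ ∈ ℂ^{n₁×n₂} satisfy P_T(F₀) = F₀, define recursively F_i = P_T((A − c·A_{Ω_i})(F_{i−1})) for i = 1,…,j₀, and set W = Σ_{i=1}^{j₀} (c·A_{Ω_i} + A^⊥)(F_{i−1}). Then: (a) P_T(W) = F₀ − F_{j₀}; and (b) ⟨W, A_k⟩ = 0 for every k ∈ {0,…,n−1} that occurs in none of Ω₁,…,Ω_{j₀}. -/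

import Mathlib

open scoped BigOperators
open Matrix

noncomputable section

/-- The Hankel lifting operator: `H(x)_{i,j} = x_{i+j}`. -/
def hankel (n₁ n₂ : ℕ) (x : Fin (n₁ + n₂ - 1) → ℂ) : Matrix (Fin n₁) (Fin n₂) ℂ :=
  fun i j => x ⟨i.1 + j.1, by have h1 := i.2; have h2 := j.2; omega⟩

/-- `w_k = |{(i,j) : i + j = k, 0 ≤ i ≤ n₁-1, 0 ≤ j ≤ n₂-1}|`. -/
def wk (n₁ n₂ k : ℕ) : ℕ :=
  (Finset.univ.filter fun p : Fin n₁ × Fin n₂ => p.1.1 + p.2.1 = k).card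

/-- The Hankel basis matrix `A_k = H(e_k) / √(w_k)`. -/
def Ak (n₁ n₂ : ℕ) (k : Fin (n₁ + n₂ - 1)) : Matrix (Fin n₁) (Fin n₂) ℂ :=
  ((Real.sqrt (wk n₁ n₂ k.1) : ℂ))⁻¹ •
    hankel n₁ n₂ (fun i => if i = k then 1 else 0)

/-- The Frobenius inner product `⟨X, Y⟩ = tr(Yᴴ X)`. -/
def finner {m n : Type*} [Fintype m] [Fintype n] (X Y : Matrix m n ℂ) : ℂ :=
  ∑ i, ∑ j, (starRingEnd ℂ) (Y i j) * X i j

/-- The projection `A(Z) = ∑_k ⟨Z, A_k⟩ A_k` onto the span of the Hankel basis. -/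
def AOp (n₁ n₂ : ℕ) (Z : Matrix (Fin n₁) (Fin n₂) ℂ) : Matrix (Fin n₁) (Fin n₂) ℂ :=
  ∑ k, finner Z (Ak n₁ n₂ k) • Ak n₁ n₂ k

/-- The sampling operator `A_Ω(Z) = ∑_{k ∈ Ω} ⟨Z, A_k⟩ A_k` (with multiplicity). -/
def AOmega (n₁ n₂ : ℕ) (Ω : Multiset (Fin (n₁ + n₂ - 1)))
    (Z : Matrix (Fin n₁) (Fin n₂) ℂ) : Matrix (Fin n₁) (Fin n₂) ℂ :=
  (Ω.map fun k => finner Z (Ak n₁ n₂ k) • Ak n₁ n₂ k).sum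

/-- The Frobenius inner product as a linear functional of its first argument. -/
def finnerLinear {m n : Type*} [Fintype m] [Fintype n] (Y : Matrix m n ℂ) :
    Matrix m n ℂ →ₗ[ℂ] ℂ where
  toFun X := finner X Y
  map_add' X X' := by simp [finner, mul_add, Finset.sum_add_distrib]
  map_smul' a X := by simp [finner, Finset.mul_sum, mul_left_comm]

theorem finnerLinear_apply {m n : Type*} [Fintype m] [Fintype n] (X Y : Matrix m n ℂ) :
    finnerLinear Y X = finner X Y := rfl

theorem Ak_apply (n₁ n₂ : ℕ) (k : Fin (n₁ + n₂ - 1)) (i : Fin n₁) (j : Fin n₂) :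
    Ak n₁ n₂ k i j =
      if i.1 + j.1 = k.1 then ((Real.sqrt (wk n₁ n₂ k.1) : ℂ))⁻¹ else 0 := by
  simp [Ak, hankel, Fin.ext_iff]

theorem wk_pos {n₁ n₂ : ℕ} (hn₁ : 1 ≤ n₁) (hn₂ : 1 ≤ n₂) (k : Fin (n₁ + n₂ - 1)) :
    0 < wk n₁ n₂ k.1 := by
  have hk := k.2
  refine Finset.card_pos.mpr
    ⟨(⟨min k.1 (n₁ - 1), by omega⟩, ⟨k.1 - min k.1 (n₁ - 1), by omega⟩), ?_⟩
  simp only [Finset.mem_filter, Finset.mem_univ, true_and]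
  omega

theorem finner_Ak_of_ne {n₁ n₂ : ℕ} {l k : Fin (n₁ + n₂ - 1)} (h : l ≠ k) :
    finner (Ak n₁ n₂ l) (Ak n₁ n₂ k) = 0 := by
  refine Finset.sum_eq_zero fun i _ => Finset.sum_eq_zero fun j _ => ?_
  rw [Ak_apply, Ak_apply]
  by_cases hk : i.1 + j.1 = k.1
  · have hl : i.1 + j.1 ≠ l.1 := fun hl => h (Fin.ext (hl.symm.trans hk))
    simp [hl]
  · simp [hk]

theorem finner_Ak_self {n₁ n₂ : ℕ} (hn₁ : 1 ≤ n₁) (hn₂ : 1 ≤ n₂) (k : Fin (n₁ + n₂ - 1)) :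
    finner (Ak n₁ n₂ k) (Ak n₁ n₂ k) = 1 := by
  have hw : (wk n₁ n₂ k.1 : ℂ) ≠ 0 := by exact_mod_cast (wk_pos hn₁ hn₂ k).ne'
  have hs : (Real.sqrt (wk n₁ n₂ k.1) : ℂ) * Real.sqrt (wk n₁ n₂ k.1) = wk n₁ n₂ k.1 := by
    exact_mod_cast Real.mul_self_sqrt (Nat.cast_nonneg _)
  have hterm : ∀ p : Fin n₁ × Fin n₂,
      (starRingEnd ℂ) (Ak n₁ n₂ k p.1 p.2) * Ak n₁ n₂ k p.1 p.2 =
        if p.1.1 + p.2.1 = k.1 then (wk n₁ n₂ k.1 : ℂ)⁻¹ else 0 := by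
    intro p
    rw [Ak_apply]
    split_ifs
    · rw [map_inv₀, Complex.conj_ofReal, ← mul_inv, hs]
    · simp
  rw [finner, ← Fintype.sum_prod_type', Finset.sum_congr rfl fun p _ => hterm p,
    ← Finset.sum_filter, Finset.sum_const, nsmul_eq_mul]
  exact mul_inv_cancel₀ hw

theorem finner_AOp {n₁ n₂ : ℕ} (hn₁ : 1 ≤ n₁) (hn₂ : 1 ≤ n₂)
    (Z : Matrix (Fin n₁) (Fin n₂) ℂ) (k : Fin (n₁ + n₂ - 1)) :
    finner (AOp n₁ n₂ Z) (Ak n₁ n₂ k) = finner Z (Ak n₁ n₂ k) := by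
  rw [← finnerLinear_apply, AOp, map_sum, Finset.sum_eq_single k]
  · rw [map_smul, finnerLinear_apply, finner_Ak_self hn₁ hn₂, smul_eq_mul, mul_one]
  · intro l _ hl
    rw [map_smul, finnerLinear_apply, finner_Ak_of_ne hl, smul_zero]
  · simp

theorem finner_AOmega_of_notMem {n₁ n₂ : ℕ} {Ω : Multiset (Fin (n₁ + n₂ - 1))}
    (Z : Matrix (Fin n₁) (Fin n₂) ℂ) {k : Fin (n₁ + n₂ - 1)} (hk : k ∉ Ω) :
    finner (AOmega n₁ n₂ Ω Z) (Ak n₁ n₂ k) = 0 := by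
  rw [← finnerLinear_apply, AOmega, map_multiset_sum, Multiset.map_map]
  refine Multiset.sum_eq_zero fun x hx => ?_
  obtain ⟨l, hl, rfl⟩ := Multiset.mem_map.mp hx
  rw [Function.comp_apply, map_smul, finnerLinear_apply,
    finner_Ak_of_ne (ne_of_mem_of_not_mem hl hk), smul_zero]

/-- `Z ↦ PZ + ZQ − PZQ` is idempotent whenever `P` and `Q` are. -/
theorem tangent_projection_idem {m n R : Type*} [Fintype m] [Fintype n] [Ring R]
    {P : Matrix m m R} {Q : Matrix n n R} (hP : P * P = P) (hQ : Q * Q = Q)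
    (Z : Matrix m n R) :
    P * (P * Z + Z * Q - P * Z * Q) + (P * Z + Z * Q - P * Z * Q) * Q -
      P * (P * Z + Z * Q - P * Z * Q) * Q = P * Z + Z * Q - P * Z * Q := by
  have hP' : ∀ Y : Matrix m n R, P * (P * Y) = P * Y := fun Y => by
    rw [← Matrix.mul_assoc, hP]
  simp only [Matrix.mul_add, Matrix.mul_sub, Matrix.add_mul, Matrix.sub_mul,
    Matrix.mul_assoc, hP', hQ]
  abel

theorem mul_conjTranspose_idem {m r : Type*} [Fintype m] [Fintype r] [DecidableEq r]
    {U : Matrix m r ℂ} (hU : Uᴴ * U = 1) : U * Uᴴ * (U * Uᴴ) = U * Uᴴ := by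
  rw [Matrix.mul_assoc, ← Matrix.mul_assoc Uᴴ, hU, Matrix.one_mul]

/-- the golfing-scheme construction of the dual certificate: with
`F_i = P_T((A − c·A_{Ω_i})(F_{i−1}))` and `W = ∑_{i=1}^{j₀} (c·A_{Ω_i} + A^⊥)(F_{i−1})`,
one has (a) `P_T(W) = F₀ − F_{j₀}`, and (b) `⟨W, A_k⟩ = 0` whenever `k` occurs in
none of the `Ω_i`. -/
theorem golfing_scheme (n₁ n₂ r : ℕ) (hn₁ : 1 ≤ n₁) (hn₂ : 1 ≤ n₂) (hr : 1 ≤ r)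
    (U : Matrix (Fin n₁) (Fin r) ℂ) (V : Matrix (Fin n₂) (Fin r) ℂ)
    (hU : Uᴴ * U = 1) (hV : Vᴴ * V = 1)
    (PT : Matrix (Fin n₁) (Fin n₂) ℂ → Matrix (Fin n₁) (Fin n₂) ℂ)
    (hPT : ∀ Z, PT Z = U * Uᴴ * Z + Z * (V * Vᴴ) - U * Uᴴ * Z * (V * Vᴴ))
    (j₀ : ℕ) (hj₀ : 1 ≤ j₀)
    (Ω : Fin j₀ → Multiset (Fin (n₁ + n₂ - 1)))
    (c : ℝ)
    (F : ℕ → Matrix (Fin n₁) (Fin n₂) ℂ)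
    (hF0 : PT (F 0) = F 0)
    (hFrec : ∀ i : Fin j₀,
      F (i.1 + 1) = PT (AOp n₁ n₂ (F i.1) - (c : ℂ) • AOmega n₁ n₂ (Ω i) (F i.1)))
    (W : Matrix (Fin n₁) (Fin n₂) ℂ)
    (hW : W = ∑ i : Fin j₀,
      ((c : ℂ) • AOmega n₁ n₂ (Ω i) (F i.1) + (F i.1 - AOp n₁ n₂ (F i.1)))) :
    PT W = F 0 - F j₀ ∧
    ∀ k : Fin (n₁ + n₂ - 1), (∀ i : Fin j₀, k ∉ Ω i) → finner W (Ak n₁ n₂ k) = 0 := by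
  constructor
  · have hadd : ∀ X Y, PT (X + Y) = PT X + PT Y := fun X Y => by
      simp only [hPT, Matrix.mul_add, Matrix.add_mul]
      abel
    let T : Matrix (Fin n₁) (Fin n₂) ℂ →+ Matrix (Fin n₁) (Fin n₂) ℂ := AddMonoidHom.mk' PT hadd
    have hidem : ∀ Z, PT (PT Z) = PT Z := fun Z => by
      simpa only [hPT] using
        tangent_projection_idem (mul_conjTranspose_idem hU) (mul_conjTranspose_idem hV) Z
    have hfix : ∀ i, i ≤ j₀ → PT (F i) = F i := by
      rintro (_ | i) hi
      · exact hF0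
      · rw [hFrec ⟨i, hi⟩, hidem]
    have hstep : ∀ i : Fin j₀,
        T ((c : ℂ) • AOmega n₁ n₂ (Ω i) (F i.1) + (F i.1 - AOp n₁ n₂ (F i.1))) =
          F i.1 - F (i.1 + 1) := fun i => by
      rw [hFrec i, ← hfix i.1 i.2.le]
      change _ = T (F i.1) - T _
      rw [← map_sub, hfix i.1 i.2.le]
      congr 1
      abel
    change T W = _
    rw [hW, map_sum, Finset.sum_congr rfl fun i _ => hstep i,
      Fin.sum_univ_eq_sum_range (fun i => F i - F (i + 1)), Finset.sum_range_sub']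
  · intro k hk
    rw [← finnerLinear_apply, hW, map_sum]
    refine Finset.sum_eq_zero fun i _ => ?_
    rw [map_add, map_sub, map_smul, finnerLinear_apply, finnerLinear_apply, finnerLinear_apply,
      finner_AOmega_of_notMem _ (hk i), finner_AOp hn₁ hn₂, smul_zero, sub_self, add_zero]
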